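/- Let Q be a strictly sign-coherent ice quiver on n mutable vertices whose mutable subquiver is a fork. Then there exists a mutation sequence of length at most 2n+3 taking Q to an ice quiver whose mutable subquiver is a fork and which has at least n-1 red vertices. -/

import Mathlib

open Matrix

section QuiverDefs

variable {V W : Type*}

/-- Mutation of an exchange matrix at the vertex `k`. -/
def mutB [DecidableEq V] (B : Matrix V V ℤ) (k : V) : Matrix V V ℤ :=
  Matrix.of fun i j =>
    if i = k ∨ j = k then -B i j else B i j + (B i k).sign * max (B i k * B k j) 0

/-- Mutation of the `C`-matrix of an extended exchange matrix `[B | C]` at the vertex `k`. -/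
def mutC [DecidableEq V] (B : Matrix V V ℤ) (C : Matrix V W ℤ) (k : V) : Matrix V W ℤ :=
  Matrix.of fun i j =>
    if i = k then -C i j else C i j + (B i k).sign * max (B i k * C k j) 0

/-- One mutation step on an extended exchange matrix `[B | C]`, regarded as a pair `(B, C)`. -/
def mutPair [DecidableEq V] (P : Matrix V V ℤ × Matrix V W ℤ) (k : V) :
    Matrix V V ℤ × Matrix V W ℤ :=
  (mutB P.1 k, mutC P.1 P.2 k)

/-- Iterated mutation of an extended exchange matrix along a list of mutable vertices. -/
def mutSeqPair [DecidableEq V] (P : Matrix V V ℤ × Matrix V W ℤ) (w : List V) :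
    Matrix V V ℤ × Matrix V W ℤ :=
  w.foldl mutPair P

/-- Iterated mutation of an exchange matrix along a list of vertices. -/
def mutSeqB [DecidableEq V] (B : Matrix V V ℤ) (w : List V) : Matrix V V ℤ :=
  w.foldl mutB B

/-- A quiver is abundant if there are at least two arrows between any two distinct vertices. -/
def QAbundant (B : Matrix V V ℤ) : Prop := ∀ i j, i ≠ j → 2 ≤ |B i j|

/-- There is a directed cycle of the quiver `B` all of whose vertices lie in `S`. -/
def HasCycleIn (B : Matrix V V ℤ) (S : Set V) : Prop :=
  ∃ (x : V) (l : List V), x ∈ S ∧ (∀ y ∈ l, y ∈ S) ∧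
    List.Chain (fun i j => 0 < B i j) x (l ++ [x])

/-- A quiver is acyclic if it has no directed cycle. -/
def QAcyclic (B : Matrix V V ℤ) : Prop := ¬ HasCycleIn B Set.univ

/-- The vertex `x` is a source: all arrows at `x` point away from `x`. -/
def QSource (B : Matrix V V ℤ) (x : V) : Prop := ∀ j, 0 ≤ B x j

/-- The vertex `x` is a sink: all arrows at `x` point into `x`. -/
def QSink (B : Matrix V V ℤ) (x : V) : Prop := ∀ j, B x j ≤ 0

/-- `B` is a fork with point of return `r`: it is abundant, not acyclic, the full subquiver
obtained by deleting `r` is acyclic, and for all `i` with `i → r` and `j` with `r → j` one has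
`b_{ji} > b_{ir}` and `b_{ji} > b_{rj}`. -/
def QFork (B : Matrix V V ℤ) (r : V) : Prop :=
  QAbundant B ∧ ¬ QAcyclic B ∧ ¬ HasCycleIn B {x | x ≠ r} ∧
    ∀ i j, 0 < B i r → 0 < B r j → B i r < B j i ∧ B r j < B j i

/-- The mutable vertex `i` is green: its `c`-vector is nonzero with all entries `≥ 0`. -/
def QGreen (C : Matrix V W ℤ) (i : V) : Prop := (∀ j, 0 ≤ C i j) ∧ C i ≠ 0

/-- The mutable vertex `i` is red: its `c`-vector is nonzero with all entries `≤ 0`. -/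
def QRed (C : Matrix V W ℤ) (i : V) : Prop := (∀ j, C i j ≤ 0) ∧ C i ≠ 0

/-- The mutable vertex `i` is blue: its `c`-vector is zero. -/
def QBlue (C : Matrix V W ℤ) (i : V) : Prop := C i = 0

/-- `i` has the same color (red/green/blue) with respect to `C` and to `C'`. -/
def SameColorQ (C C' : Matrix V W ℤ) (i : V) : Prop :=
  (QRed C i ↔ QRed C' i) ∧ (QGreen C i ↔ QGreen C' i) ∧ (QBlue C i ↔ QBlue C' i)

/-- The `c`-vectors of `i` and `j` have the same sign (`sgn(c_i) = sgn(c_j)`). -/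
def SameSignQ (C : Matrix V W ℤ) (i j : V) : Prop :=
  (QGreen C i ∧ QGreen C j) ∨ (QRed C i ∧ QRed C j)

/-- The `c`-vectors of `i` and `j` have opposite signs (`sgn(c_i) = -sgn(c_j)`). -/
def OppSignQ (C : Matrix V W ℤ) (i j : V) : Prop :=
  (QGreen C i ∧ QRed C j) ∨ (QRed C i ∧ QGreen C j)

/-- An ice quiver is uniformly sign-coherent if after every mutation sequence every mutable
vertex is red, green, or blue, and not every mutable vertex of the initial quiver is blue. -/
def USC [DecidableEq V] (P : Matrix V V ℤ × Matrix V W ℤ) : Prop :=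
  (∀ (w : List V) (i : V),
      QRed (mutSeqPair P w).2 i ∨ QGreen (mutSeqPair P w).2 i ∨ QBlue (mutSeqPair P w).2 i) ∧
    ¬ ∀ i, QBlue P.2 i

/-- An ice quiver is strictly sign-coherent if after every mutation sequence every mutable
vertex is red or green. -/
def SSC [DecidableEq V] (P : Matrix V V ℤ × Matrix V W ℤ) : Prop :=
  ∀ (w : List V) (i : V), QRed (mutSeqPair P w).2 i ∨ QGreen (mutSeqPair P w).2 i

/-- The four sign conditions at the distinguished vertex `r`:
(1) every mutable vertex is red or green;
(2) if every entry of `b_{rj}·c_j` is `≥ 0` for some `j ≠ r`, then `sgn(c_j) = sgn(c_r)` or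
    `sgn(c_j)·c_j ≥ sgn(c_r)·c_r` entrywise (i.e. `|c_r| ≤ |c_j|` entrywise);
(3) if every entry of `b_{rj}·c_j` is `≤ 0` for some `j ≠ r`, then `sgn(c_j) = -sgn(c_r)`;
(4) if every entry of `b_{ij}·c_j` is `≥ 0` for distinct `i, j` both `≠ r`,
    then `sgn(c_i) = sgn(c_j)`. -/
def FourConds (Bw : Matrix V V ℤ) (Cw : Matrix V W ℤ) (r : V) : Prop :=
  (∀ i, QRed Cw i ∨ QGreen Cw i) ∧
  (∀ j, j ≠ r → (∀ t, 0 ≤ Bw r j * Cw j t) →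
    (SameSignQ Cw j r ∨ ∀ t, |Cw r t| ≤ |Cw j t|)) ∧
  (∀ j, j ≠ r → (∀ t, Bw r j * Cw j t ≤ 0) → OppSignQ Cw j r) ∧
  (∀ i j, i ≠ j → i ≠ r → j ≠ r → (∀ t, 0 ≤ Bw i j * Cw j t) → SameSignQ Cw i j)

end QuiverDefs

section Aux

variable {V : Type*} [DecidableEq V]

/-- Working form of a fork (for skew-symmetric matrices). -/
structure Fk (B : Matrix V V ℤ) (r : V) : Prop where
  skew : ∀ i j, B j i = -B i j
  ab : ∀ i j, i ≠ j → B i j ≤ -2 ∨ 2 ≤ B i j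
  trans : ∀ i j k, i ≠ r → j ≠ r → k ≠ r → 0 < B i j → 0 < B j k → 0 < B i k
  ex_in : ∃ i, 0 < B i r
  ex_out : ∃ j, 0 < B r j
  big : ∀ i j, 0 < B i r → 0 < B r j → B i r < B j i ∧ B r j < B j i

theorem Fk.diag {B : Matrix V V ℤ} {r : V} (h : Fk B r) (i : V) : B i i = 0 := by
  have := h.skew i i
  omega

theorem Fk.neg {B : Matrix V V ℤ} {r : V} (h : Fk B r) : Fk (-B) r := by
  refine ⟨?_, ?_, ?_, ?_, ?_, ?_⟩
  · intro i j
    have := h.skew i j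
    simp only [Matrix.neg_apply]
    omega
  · intro i j hij
    have := h.ab i j hij
    simp only [Matrix.neg_apply]
    omega
  · intro i j k hi hj hk h1 h2
    simp only [Matrix.neg_apply] at *
    have := h.trans k j i hk hj hi (by have := h.skew j k; omega) (by have := h.skew i j; omega)
    have := h.skew i k
    omega
  · obtain ⟨j, hj⟩ := h.ex_out
    refine ⟨j, ?_⟩
    have := h.skew r j
    simp only [Matrix.neg_apply]
    omega
  · obtain ⟨j, hj⟩ := h.ex_in
    refine ⟨j, ?_⟩
    have := h.skew r j
    simp only [Matrix.neg_apply]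
    omega
  · intro i j h1 h2
    simp only [Matrix.neg_apply] at *
    have a1 := h.skew r j
    have a2 := h.skew r i
    have a3 := h.skew i j
    have := h.big j i (by omega) (by omega)
    omega

theorem mutB_self_left (B : Matrix V V ℤ) (k j : V) : mutB B k k j = -B k j := by
  simp [mutB]

theorem mutB_self_right (B : Matrix V V ℤ) (k j : V) : mutB B k j k = -B j k := by
  simp [mutB]

theorem mutB_io (B : Matrix V V ℤ) {i j k : V} (hi : i ≠ k) (hj : j ≠ k)
    (h1 : 0 < B i k) (h2 : 0 < B k j) : mutB B k i j = B i j + B i k * B k j := by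
  have : 0 < B i k * B k j := mul_pos h1 h2
  simp [mutB, hi, hj, Int.sign_eq_one_of_pos h1, max_eq_left this.le]

theorem mutB_oi (B : Matrix V V ℤ) {i j k : V} (hi : i ≠ k) (hj : j ≠ k)
    (h1 : B i k < 0) (h2 : B k j < 0) : mutB B k i j = B i j - B i k * B k j := by
  have : 0 < B i k * B k j := mul_pos_of_neg_of_neg h1 h2
  simp [mutB, hi, hj, Int.sign_eq_neg_one_of_neg h1, max_eq_left this.le]
  ring

theorem mutB_same (B : Matrix V V ℤ) {i j k : V} (hi : i ≠ k) (hj : j ≠ k)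
    (h : B i k * B k j ≤ 0) : mutB B k i j = B i j := by
  simp [mutB, hi, hj, max_eq_right h]

theorem mutB_ii (B : Matrix V V ℤ) {i j k : V} (hi : i ≠ k) (hj : j ≠ k)
    (h1 : 0 < B i k) (h2 : B k j < 0) : mutB B k i j = B i j :=
  mutB_same B hi hj (mul_neg_of_pos_of_neg h1 h2).le

theorem mutB_oo (B : Matrix V V ℤ) {i j k : V} (hi : i ≠ k) (hj : j ≠ k)
    (h1 : B i k < 0) (h2 : 0 < B k j) : mutB B k i j = B i j :=
  mutB_same B hi hj (mul_neg_of_neg_of_pos h1 h2).le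

theorem mutB_skew {B : Matrix V V ℤ} (h : ∀ i j, B j i = -B i j) (k i j : V) :
    mutB B k j i = - mutB B k i j := by
  by_cases hi : i = k
  · subst hi; rw [mutB_self_left, mutB_self_right, h]
  by_cases hj : j = k
  · subst hj; rw [mutB_self_left, mutB_self_right, h]
  simp only [mutB, Matrix.of_apply, hi, hj, or_self, if_false]
  rw [h i j, h i k, h k j]
  have : -B k j * -B i k = B i k * B k j := by ring
  rw [this]
  rcases lt_trichotomy (B i k) 0 with a | a | a <;> rcases lt_trichotomy (B k j) 0 with b | b | b
  all_goals first
    | rw [max_eq_right (by nlinarith)]; ring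
    | (rw [Int.sign_eq_neg_one_of_neg a, Int.sign_eq_one_of_pos (by omega)]; ring)
    | (rw [Int.sign_eq_one_of_pos a, Int.sign_eq_neg_one_of_neg (by omega)]; ring)

/-- Key inequality: after mutation the in-vertices of `k` dominate the out-vertices. -/
theorem Fk.key {B : Matrix V V ℤ} {r k i o : V} (h : Fk B r) (hk : k ≠ r)
    (hi : 0 < B i k) (ho : 0 < B k o) :
    B i k < B i o + B i k * B k o ∧ B k o < B i o + B i k * B k o := by
  have d := h.diag k
  have hik : i ≠ k := by rintro rfl; omega
  have hok : o ≠ k := by rintro rfl; omega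
  have hi2 : 2 ≤ B i k := by have := h.ab i k hik; omega
  have ho2 : 2 ≤ B k o := by have := h.ab k o hok.symm; omega
  have hio : i ≠ o := by
    rintro rfl
    have := h.skew i k
    omega
  by_cases hpos : 0 < B i o
  · constructor <;> nlinarith
  by_cases hir : i = r
  · subst hir
    have a := h.ab i o hio
    have b := h.skew i o
    have := h.big o k (by omega) hi
    constructor <;> nlinarith
  by_cases hor : o = r
  · subst hor
    have a := h.ab i o hio
    have b := h.skew i o
    have := h.big k i ho (by omega)
    constructor <;> nlinarith
  · exact absurd (h.trans i k o hir hk hor hi ho) hpos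

theorem Fk.exIn {B : Matrix V V ℤ} {r : V} (h : Fk B r) (k : V) : ∃ i, 0 < B i k := by
  by_cases hk : k = r
  · subst hk; exact h.ex_in
  rcases h.ab k r hk with a | a
  · exact ⟨r, by have := h.skew k r; omega⟩
  · obtain ⟨j, hj⟩ := h.ex_out
    have := h.big k j (by omega) hj
    exact ⟨j, by omega⟩

theorem Fk.exOut {B : Matrix V V ℤ} {r : V} (h : Fk B r) (k : V) : ∃ i, 0 < B k i := by
  obtain ⟨i, hi⟩ := h.neg.exIn k
  refine ⟨i, ?_⟩
  have := h.skew i k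
  simp only [Matrix.neg_apply] at hi
  omega

theorem Fk.mutate {B : Matrix V V ℤ} {r k : V} (h : Fk B r) (hk : k ≠ r) : Fk (mutB B k) k := by
  have sk := h.skew
  have sk' := fun i j => mutB_skew h.skew k i j
  have d := h.diag k
  -- classification of the other vertices
  have cls : ∀ i, i ≠ k → (0 < B i k ∧ B k i < 0) ∨ (B i k < 0 ∧ 0 < B k i) := by
    intro i hi
    have := h.ab i k hi
    have := sk i k
    omega
  have pos : ∀ i o, i ≠ k → o ≠ k → 0 < B i k → 0 < B k o → 0 < mutB B k i o := by
    intro i o hik hok hi ho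
    rw [mutB_io B hik hok hi ho]
    have := h.key hk hi ho
    omega
  have trI : ∀ i j l, 0 < B i k → 0 < B j k → 0 < B l k → 0 < B i j → 0 < B j l → 0 < B i l := by
    intro i j l hi hj hl h1 h2
    have src : ∀ x, 0 < B r k → 0 < B x k → ¬ 0 < B x r := by
      intro x a1 a2 a3
      have := h.big x k a3 a1
      have := sk x k
      omega
    by_cases hir : i = r
    · subst hir
      by_contra hneg
      have hil : i ≠ l := by
        rintro rfl
        exact src j hi hj h2
      have := h.ab i l hil
      have := sk i l
      exact src l hi hl (by omega)
    by_cases hjr : j = r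
    · subst hjr
      exact absurd h1 (src i hj hi)
    by_cases hlr : l = r
    · subst hlr
      exact absurd h2 (src j hl hj)
    exact h.trans i j l hir hjr hlr h1 h2
  have trO : ∀ i j l, 0 < B k i → 0 < B k j → 0 < B k l → 0 < B i j → 0 < B j l → 0 < B i l := by
    intro i j l hi hj hl h1 h2
    have snk : ∀ x, 0 < B k r → 0 < B k x → ¬ 0 < B r x := by
      intro x a1 a2 a3
      have := h.big k x a1 a3
      have := sk x k
      omega
    by_cases hlr : l = r
    · subst hlr
      by_contra hneg
      have hil : i ≠ l := by
        rintro rfl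
        exact snk j hi hj h1
      have := h.ab i l hil
      have := sk i l
      exact snk i hl hi (by omega)
    by_cases hjr : j = r
    · subst hjr
      exact absurd h2 (snk l hj hl)
    by_cases hir : i = r
    · subst hir
      exact absurd h1 (snk j hi hj)
    exact h.trans i j l hir hjr hlr h1 h2
  refine ⟨sk', ?_, ?_, ?_, ?_, ?_⟩
  · intro i j hij
    by_cases hi : i = k
    · subst hi
      rw [mutB_self_left]
      have := h.ab i j hij
      omega
    by_cases hj : j = k
    · subst hj
      rw [mutB_self_right]
      have := h.ab i j hij
      omega
    rcases cls i hi with ⟨a1, a2⟩ | ⟨a1, a2⟩ <;> rcases cls j hj with ⟨b1, b2⟩ | ⟨b1, b2⟩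
    · rw [mutB_ii B hi hj a1 b2]; exact h.ab i j hij
    · rw [mutB_io B hi hj a1 b2]
      have := h.key hk a1 b2
      omega
    · rw [sk' j i, mutB_io B hj hi b1 a2]
      have := h.key hk b1 a2
      omega
    · rw [mutB_oo B hi hj a1 b2]; exact h.ab i j hij
  · intro i j l hi hj hl h1 h2
    rcases cls i hi with ⟨a1, a2⟩ | ⟨a1, a2⟩ <;> rcases cls j hj with ⟨b1, b2⟩ | ⟨b1, b2⟩ <;>
      rcases cls l hl with ⟨c1, c2⟩ | ⟨c1, c2⟩
    · rw [mutB_ii B hi hj a1 b2] at h1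
      rw [mutB_ii B hj hl b1 c2] at h2
      rw [mutB_ii B hi hl a1 c2]
      exact trI i j l a1 b1 c1 h1 h2
    · exact pos i l hi hl a1 c2
    · have := pos l j hl hj c1 b2
      have := sk' l j
      omega
    · exact pos i l hi hl a1 c2
    · have := pos j i hj hi b1 a2
      have := sk' j i
      omega
    · have := pos j i hj hi b1 a2
      have := sk' j i
      omega
    · have := pos l j hl hj c1 b2
      have := sk' l j
      omega
    · rw [mutB_oo B hi hj a1 b2] at h1
      rw [mutB_oo B hj hl b1 c2] at h2
      rw [mutB_oo B hi hl a1 c2]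
      exact trO i j l a2 b2 c2 h1 h2
  · obtain ⟨i, hi⟩ := h.exOut k
    refine ⟨i, ?_⟩
    rw [mutB_self_right]
    have := sk i k
    omega
  · obtain ⟨i, hi⟩ := h.exIn k
    refine ⟨i, ?_⟩
    rw [mutB_self_left]
    have := sk i k
    omega
  · intro o i ho hi
    rw [mutB_self_right] at ho ⊢
    rw [mutB_self_left] at hi ⊢
    have e1 := sk o k
    have e2 := sk i k
    have hok : o ≠ k := by rintro rfl; omega
    have hik : i ≠ k := by rintro rfl; omega
    rw [mutB_io B hik hok (by omega) (by omega)]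
    have := h.key hk (i := i) (o := o) (by omega) (by omega)
    omega

/-- Chain facts. -/
theorem chain_has_pred {R : V → V → Prop} : ∀ (l : List V) (x : V), List.Chain R x l →
    ∀ y ∈ l, ∃ z, R z y := by
  intro l
  induction l with
  | nil => simp
  | cons a l ih =>
    intro x h y hy
    rw [List.Chain, List.isChain_cons_cons] at h
    rcases List.mem_cons.1 hy with rfl | hy
    · exact ⟨x, h.1⟩
    · exact ih a h.2 y hy

theorem chain_has_succ {R : V → V → Prop} (z : V) : ∀ (l : List V) (x : V),
    List.Chain R x (l ++ [z]) → ∀ y ∈ x :: l, ∃ z, R y z := by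
  intro l
  induction l with
  | nil =>
    intro x h y hy
    simp only [List.Chain, List.nil_append, List.isChain_cons_cons] at h
    simp only [List.mem_singleton] at hy
    subst hy
    exact ⟨z, h.1⟩
  | cons a l ih =>
    intro x h y hy
    rw [List.Chain, List.cons_append, List.isChain_cons_cons] at h
    rcases List.mem_cons.1 hy with rfl | hy
    · exact ⟨a, h.1⟩
    · exact ih a h.2 y hy

theorem chain_trans {R : V → V → Prop} {S : Set V}
    (ht : ∀ i j k, i ∈ S → j ∈ S → k ∈ S → R i j → R j k → R i k) (z : V) (hz : z ∈ S) :
    ∀ (l : List V) (x : V), x ∈ S → (∀ y ∈ l, y ∈ S) → List.Chain R x (l ++ [z]) → R x z := by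
  intro l
  induction l with
  | nil =>
    intro x hx _ h
    simp only [List.Chain, List.nil_append, List.isChain_cons_cons] at h
    exact h.1
  | cons a l ih =>
    intro x hx hl h
    rw [List.Chain, List.cons_append, List.isChain_cons_cons] at h
    have ha : a ∈ S := hl a (by simp)
    exact ht x a z hx ha hz h.1 (ih a ha (fun y hy => hl y (by simp [hy])) h.2)

theorem Fk.toQFork {B : Matrix V V ℤ} {r : V} (h : Fk B r) : QFork B r := by
  refine ⟨?_, ?_, ?_, h.big⟩
  · intro i j hij
    rcases h.ab i j hij with a | a
    · rw [abs_of_neg (by omega)]; omega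
    · rw [abs_of_pos (by omega)]; omega
  · rw [QAcyclic, not_not]
    obtain ⟨i, hi⟩ := h.ex_in
    obtain ⟨j, hj⟩ := h.ex_out
    have := h.big i j hi hj
    refine ⟨r, [j, i], trivial, fun _ _ => trivial, ?_⟩
    simp only [List.Chain, List.cons_append, List.nil_append, List.isChain_cons_cons]
    refine ⟨hj, by omega, hi, ?_⟩
    simp
  · rintro ⟨x, l, hx, hl, hc⟩
    have := chain_trans (R := fun i j => 0 < B i j) (S := {x | x ≠ r})
      (fun i j k hi hj hk => h.trans i j k hi hj hk) x hx l x hx hl hc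
    have := h.diag x
    omega

theorem Fk.ofQFork {B : Matrix V V ℤ} {r : V} (skew : ∀ i j, B j i = -B i j)
    (h : QFork B r) : Fk B r := by
  obtain ⟨hab, hcyc, hac, hbig⟩ := h
  have ab : ∀ i j, i ≠ j → B i j ≤ -2 ∨ 2 ≤ B i j := by
    intro i j hij
    have := hab i j hij
    rcases abs_cases (B i j) with ⟨h1, h2⟩ | ⟨h1, h2⟩ <;> omega
  have key : ∀ x l, List.Chain (fun i j => 0 < B i j) x (l ++ [x]) → r ∈ x :: l := by
    intro x l hc
    by_contra hr
    simp only [List.mem_cons, not_or] at hr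
    refine hac ⟨x, l, Ne.symm hr.1, ?_, hc⟩
    rintro y hy rfl
    exact hr.2 hy
  rw [QAcyclic, not_not] at hcyc
  obtain ⟨x, l, -, -, hc⟩ := hcyc
  have hr := key x l hc
  refine ⟨skew, ab, ?_, ?_, ?_, hbig⟩
  · intro i j k hi hj hk h1 h2
    by_contra hneg
    have hik : i ≠ k := by
      rintro rfl
      have := skew i j
      omega
    have := ab i k hik
    have := skew i k
    refine hac ⟨i, [j, k], hi, ?_, ?_⟩
    · intro y hy
      simp only [List.mem_cons, List.not_mem_nil, or_false] at hy
      rcases hy with rfl | rfl <;> assumption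
    · simp only [List.Chain, List.cons_append, List.nil_append, List.isChain_cons_cons]
      refine ⟨h1, h2, by omega, ?_⟩
      simp
  · refine chain_has_pred (R := fun i j => 0 < B i j) _ x hc r ?_
    simp only [List.mem_cons] at hr
    simp only [List.mem_append, List.mem_singleton]
    tauto
  · exact chain_has_succ (R := fun i j => 0 < B i j) x l x hc r hr

/-! ### Scalar version of the mutation -/

/-- Mutation of scalar weights. -/
def mc (B : Matrix V V ℤ) (c : V → ℤ) (k : V) : V → ℤ := fun i =>
  if i = k then -c i else c i + (B i k).sign * max (B i k * c k) 0

/-- One scalar mutation step. -/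
def stp (P : Matrix V V ℤ × (V → ℤ)) (k : V) : Matrix V V ℤ × (V → ℤ) :=
  (mutB P.1 k, mc P.1 P.2 k)

/-- Iterated scalar mutation. -/
def run (P : Matrix V V ℤ × (V → ℤ)) (w : List V) : Matrix V V ℤ × (V → ℤ) := w.foldl stp P

theorem run_nil (P : Matrix V V ℤ × (V → ℤ)) : run P [] = P := rfl

theorem run_cons (P : Matrix V V ℤ × (V → ℤ)) (k : V) (w : List V) :
    run P (k :: w) = run (stp P k) w := rfl

theorem run_append (P : Matrix V V ℤ × (V → ℤ)) (w w' : List V) :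
    run P (w ++ w') = run (run P w) w' := by
  simp [run]

/-- No weight ever vanishes. -/
def NV (P : Matrix V V ℤ × (V → ℤ)) : Prop := ∀ w i, (run P w).2 i ≠ 0

theorem NV.run {P : Matrix V V ℤ × (V → ℤ)} (h : NV P) (w : List V) : NV (run P w) := by
  intro w' i
  rw [← run_append]
  exact h _ i

theorem NV.stp {P : Matrix V V ℤ × (V → ℤ)} (h : NV P) (k : V) : NV (stp P k) := h.run [k]

theorem NV.ne {P : Matrix V V ℤ × (V → ℤ)} (h : NV P) (i : V) : P.2 i ≠ 0 := h [] i

theorem mutB_neg (B : Matrix V V ℤ) (k : V) : mutB (-B) k = -mutB B k := by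
  ext i j
  simp only [mutB, Matrix.of_apply, Matrix.neg_apply, neg_mul_neg, Int.sign_neg]
  split_ifs <;> ring

theorem mc_neg (B : Matrix V V ℤ) (c : V → ℤ) (k : V) : mc (-B) (-c) k = -mc B c k := by
  ext i
  simp only [mc, Pi.neg_apply, Matrix.neg_apply, neg_mul_neg, Int.sign_neg]
  split_ifs <;> ring

theorem stp_neg (P : Matrix V V ℤ × (V → ℤ)) (k : V) : stp (-P) k = -stp P k := by
  ext1
  · exact mutB_neg P.1 k
  · exact mc_neg P.1 P.2 k

theorem run_neg (w : List V) : ∀ (P : Matrix V V ℤ × (V → ℤ)), run (-P) w = -run P w := by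
  induction w with
  | nil => intro P; rfl
  | cons k w ih => intro P; rw [run_cons, run_cons, stp_neg, ih]

theorem NV.neg {P : Matrix V V ℤ × (V → ℤ)} (h : NV P) : NV (-P) := by
  intro w i
  rw [run_neg]
  simpa using h w i

theorem mc_self (B : Matrix V V ℤ) (c : V → ℤ) (k : V) : mc B c k k = -c k := by simp [mc]

theorem mc_pos_in (B : Matrix V V ℤ) (c : V → ℤ) {k i : V} (hi : i ≠ k) (hc : 0 < c k)
    (hb : 0 < B i k) : mc B c k i = c i + B i k * c k := by
  have : 0 < B i k * c k := mul_pos hb hc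
  simp [mc, hi, Int.sign_eq_one_of_pos hb, max_eq_left this.le]

theorem mc_pos_out (B : Matrix V V ℤ) (c : V → ℤ) {k i : V} (hi : i ≠ k) (hc : 0 < c k)
    (hb : B i k ≤ 0) : mc B c k i = c i := by
  have : B i k * c k ≤ 0 := mul_nonpos_of_nonpos_of_nonneg hb hc.le
  simp [mc, hi, max_eq_right this]

theorem mc_neg_out (B : Matrix V V ℤ) (c : V → ℤ) {k i : V} (hi : i ≠ k) (hc : c k < 0)
    (hb : B i k < 0) : mc B c k i = c i - B i k * c k := by
  have : 0 < B i k * c k := mul_pos_of_neg_of_neg hb hc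
  simp [mc, hi, Int.sign_eq_neg_one_of_neg hb, max_eq_left this.le]
  ring

theorem mc_neg_in (B : Matrix V V ℤ) (c : V → ℤ) {k i : V} (hi : i ≠ k) (hc : c k < 0)
    (hb : 0 ≤ B i k) : mc B c k i = c i := by
  have : B i k * c k ≤ 0 := mul_nonpos_of_nonneg_of_nonpos hb hc.le
  simp [mc, hi, max_eq_right this]

/-! ### Stage 3: final reddening -/

theorem stage3 [Fintype V] (s : V) : ∀ (N : ℕ) (P : Matrix V V ℤ × (V → ℤ)) (ρ : V),
    (Finset.univ.filter (fun i => i ≠ s ∧ 0 < P.2 i)).card ≤ N → NV P → Fk P.1 ρ →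
    (ρ = s ∨ P.2 ρ < 0) →
    (∀ i j k, i ≠ s → j ≠ s → k ≠ s → 0 < P.1 i j → 0 < P.1 j k → 0 < P.1 i k) →
    (∀ i j, i ≠ s → j ≠ s → 0 < P.1 i j → P.2 i < 0 → 0 < P.2 j → False) →
    ∃ w : List V, w.length ≤ N ∧ (∃ ρ', Fk (run P w).1 ρ') ∧
      ∀ i, i ≠ s → (run P w).2 i < 0 := by
  intro N
  induction N with
  | zero =>
    intro P ρ hN hnv hF _ _ _
    refine ⟨[], le_rfl, ⟨ρ, hF⟩, ?_⟩
    intro i hi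
    rw [run_nil]
    have h0 := hnv.ne i
    by_contra hneg
    have : i ∈ Finset.univ.filter (fun i => i ≠ s ∧ 0 < P.2 i) := by
      simp only [Finset.mem_filter, Finset.mem_univ, true_and]
      exact ⟨hi, by omega⟩
    have := Finset.card_pos.2 ⟨i, this⟩
    omega
  | succ N ih =>
    intro P ρ hN hnv hF hρ htr hbad
    by_cases hex : ∃ k, k ≠ s ∧ 0 < P.2 k
    swap
    · push Not at hex
      refine ⟨[], Nat.zero_le _, ⟨ρ, hF⟩, ?_⟩
      intro i hi
      have h0 := hnv.ne i
      have := hex i hi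
      rw [run_nil]
      omega
    -- a green vertex `k` without green predecessors off `s`
    obtain ⟨k, hks, hkg, hkmin⟩ : ∃ k, k ≠ s ∧ 0 < P.2 k ∧
        ∀ i, i ≠ s → 0 < P.2 i → ¬ 0 < P.1 i k := by
      let R : {i : V // i ≠ s ∧ 0 < P.2 i} → {i : V // i ≠ s ∧ 0 < P.2 i} → Prop :=
        fun a b => 0 < P.1 a b
      have : IsTrans _ R := ⟨fun a b c h1 h2 => htr a b c a.2.1 b.2.1 c.2.1 h1 h2⟩
      have : Std.Irrefl R := ⟨fun a h => by
        have := hF.diag a.1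
        have h' : 0 < P.1 a a := h
        omega⟩
      have wf : WellFounded R := Finite.wellFounded_of_trans_of_irrefl R
      obtain ⟨k0, hk0⟩ := hex
      obtain ⟨m, -, hm⟩ := wf.has_min Set.univ ⟨⟨k0, hk0⟩, trivial⟩
      exact ⟨m.1, m.2.1, m.2.2, fun i h1 h2 h3 => hm ⟨i, h1, h2⟩ trivial h3⟩
    have hin : ∀ i, 0 < P.1 i k → i = s := by
      intro i hi
      by_contra his
      rcases lt_or_gt_of_ne (hnv.ne i) with a | a
      · exact hbad i k his hks hi a hkg
      · exact hkmin i his a hi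
    have hkρ : k ≠ ρ := by
      rintro rfl
      rcases hρ with h | h
      · exact hks h
      · omega
    have hout : ∀ i, i ≠ s → i ≠ k → P.1 i k < 0 ∧ 0 < P.1 k i := by
      intro i his hik
      have h1 := hF.ab i k hik
      have h2 := hF.skew i k
      have h3 : ¬ 0 < P.1 i k := fun h => his (hin i h)
      omega
    have hB : ∀ i j, i ≠ s → j ≠ s → i ≠ k → j ≠ k → (stp P k).1 i j = P.1 i j := by
      intro i j hi hj hik hjk
      exact mutB_oo P.1 hik hjk (hout i hi hik).1 (hout j hj hjk).2
    have hC : ∀ i, i ≠ s → i ≠ k → (stp P k).2 i = P.2 i := by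
      intro i hi hik
      exact mc_pos_out P.1 P.2 hik hkg (hout i hi hik).1.le
    have hCk : (stp P k).2 k = -P.2 k := mc_self P.1 P.2 k
    have hBk : ∀ j, (stp P k).1 k j = - P.1 k j := fun j => mutB_self_left P.1 k j
    have hBk' : ∀ j, (stp P k).1 j k = - P.1 j k := fun j => mutB_self_right P.1 k j
    have hd := hF.diag k
    have hnk : ∀ j, j ≠ s → ¬ 0 < (stp P k).1 k j := by
      intro j hj h
      rw [hBk] at h
      by_cases hjk : j = k
      · subst hjk; omega
      · have := hout j hj hjk
        omega
    have hF' : Fk (stp P k).1 k := hF.mutate hkρ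
    refine Exists.elim (ih (stp P k) k ?_ (hnv.stp k) hF' (Or.inr (by omega)) ?_ ?_) ?_
    rotate_left 3
    · rintro w ⟨hw, hf, hr⟩
      refine ⟨k :: w, by simpa using hw, ?_, ?_⟩
      · rw [run_cons]; exact hf
      · rw [run_cons]; exact hr
    · have hlt : (Finset.univ.filter (fun i => i ≠ s ∧ 0 < (stp P k).2 i)) ⊂
          (Finset.univ.filter (fun i => i ≠ s ∧ 0 < P.2 i)) := by
        rw [Finset.ssubset_iff_of_subset]
        · refine ⟨k, by simp [hks, hkg], ?_⟩
          simp only [Finset.mem_filter, Finset.mem_univ, true_and, not_and]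
          intro _
          omega
        · intro i
          simp only [Finset.mem_filter, Finset.mem_univ, true_and]
          rintro ⟨h1, h2⟩
          refine ⟨h1, ?_⟩
          by_cases hik : i = k
          · rw [hik]; exact hkg
          · rwa [hC i h1 hik] at h2
      have := Finset.card_lt_card hlt
      omega
    · intro i j l hi hj hl h1 h2
      by_cases hik : i = k
      · subst hik; exact absurd h1 (hnk j hj)
      by_cases hjk : j = k
      · subst hjk; exact absurd h2 (hnk l hl)
      by_cases hlk : l = k
      · subst hlk
        rw [hBk']
        have := hout i hi hik
        omega
      rw [hB i j hi hj hik hjk] at h1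
      rw [hB j l hj hl hjk hlk] at h2
      rw [hB i l hi hl hik hlk]
      exact htr i j l hi hj hl h1 h2
    · intro i j hi hj h1 h2 h3
      by_cases hik : i = k
      · subst hik; exact hnk j hj h1
      by_cases hjk : j = k
      · subst hjk; omega
      rw [hB i j hi hj hik hjk] at h1
      rw [hC i hi hik] at h2
      rw [hC j hj hjk] at h3
      exact hbad i j hi hj h1 h2 h3

/-! ### Stage 2: sorting colours -/

/-- State of stage 2 with a green point of return. -/
def StG (P : Matrix V V ℤ × (V → ℤ)) (ρ : V) (M : Finset V) : Prop :=
  Fk P.1 ρ ∧ 0 < P.2 ρ ∧ (∀ i ∈ M, 0 < P.1 ρ i) ∧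
    ∀ i j, i ≠ ρ → j ≠ ρ → 0 < P.1 i j → P.2 i < 0 → 0 < P.2 j → i ∈ M ∧ j ∈ M

/-- State of stage 2, up to duality. -/
def St (P : Matrix V V ℤ × (V → ℤ)) (ρ : V) (M : Finset V) : Prop :=
  StG P ρ M ∨ StG (-P) ρ M

theorem St.neg {P : Matrix V V ℤ × (V → ℤ)} {ρ : V} {M : Finset V} (h : St P ρ M) :
    St (-P) ρ M := by
  rcases h with h | h
  · right; rwa [neg_neg]
  · left; exact h

theorem stage2_step {P : Matrix V V ℤ × (V → ℤ)} {ρ : V} {M : Finset V} (hnv : NV P)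
    (h : StG P ρ M) (hM : M.Nonempty) :
    ∃ k M', M'.card < M.card ∧ St (stp P k) k M' := by
  obtain ⟨hF, hρ, hMρ, hbad⟩ := h
  obtain ⟨k, hkM, hmax⟩ := Finset.exists_max_image M (fun i => |P.2 i|) hM
  have hρk := hMρ k hkM
  have hkρ : k ≠ ρ := by
    rintro rfl
    have := hF.diag k
    omega
  have hd := hF.diag k
  have sk := hF.skew
  have hF' : Fk (stp P k).1 k := hF.mutate hkρ
  have sk' := hF'.skew
  have cls : ∀ i, i ≠ k → (2 ≤ P.1 i k ∧ P.1 k i ≤ -2) ∨ (P.1 i k ≤ -2 ∧ 2 ≤ P.1 k i) := by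
    intro i hi
    have := hF.ab i k hi
    have := sk i k
    omega
  have pos : ∀ i o, i ≠ k → o ≠ k → 0 < P.1 i k → 0 < P.1 k o → 0 < (stp P k).1 i o := by
    intro i o hik hok hi ho
    have e : (stp P k).1 i o = _ := mutB_io P.1 hik hok hi ho
    rw [e]
    have := hF.key hkρ hi ho
    omega
  have hCk : (stp P k).2 k = -P.2 k := mc_self P.1 P.2 k
  have hskρ := sk ρ k
  rcases lt_or_gt_of_ne (hnv.ne k) with hk | hk
  · -- `k` red
    have hout : ∀ i, i ≠ k → P.1 i k < 0 → (stp P k).2 i < 0 := by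
      intro i hik hi
      have e : (stp P k).2 i = _ := mc_neg_out P.1 P.2 hik hk hi
      rw [e]
      have c := cls i hik
      have c' : P.1 i k ≤ -2 := by omega
      by_cases hiM : i ∈ M
      · have := hmax i hiM
        simp only [abs_of_neg hk] at this
        have := le_abs_self (P.2 i)
        nlinarith
      · have hiρ : i ≠ ρ := by rintro rfl; omega
        have : P.2 i ≤ 0 := by
          by_contra hneg
          exact hiM (hbad k i hkρ hiρ (by omega) hk (by omega)).2
        nlinarith
    have hin : ∀ i, i ≠ k → 0 < P.1 i k → (stp P k).2 i = P.2 i := by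
      intro i hik hi
      exact mc_neg_in P.1 P.2 hik hk hi.le
    refine ⟨k, M.filter (fun i => 0 < P.1 i k), ?_, Or.inl ⟨hF', by omega, ?_, ?_⟩⟩
    · apply Finset.card_lt_card
      rw [Finset.ssubset_iff_of_subset (Finset.filter_subset _ _)]
      refine ⟨k, hkM, ?_⟩
      simp only [Finset.mem_filter, not_and]
      intro _
      omega
    · intro i hi
      rw [Finset.mem_filter] at hi
      have e : (stp P k).1 k i = _ := mutB_self_left P.1 k i
      rw [e]
      have := sk i k
      omega
    · intro i j hik hjk h1 h2 h3
      have hj : 0 < P.1 j k := by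
        by_contra hneg
        have := cls j hjk
        have := hout j hjk (by omega)
        omega
      have hi : 0 < P.1 i k := by
        by_contra hneg
        have := cls i hik
        have := pos j i hjk hik hj (by omega)
        have := sk' i j
        omega
      have cj := cls j hjk
      rw [hin i hik hi] at h2
      rw [hin j hjk hj] at h3
      have e : (stp P k).1 i j = _ := mutB_ii P.1 hik hjk hi (by omega)
      rw [e] at h1
      have hiρ : i ≠ ρ := by rintro rfl; omega
      have hjρ : j ≠ ρ := by
        rintro rfl
        have := hF.big i k h1 hρk
        have := cls i hik
        omega
      have := hbad i j hiρ hjρ h1 h2 h3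
      simp only [Finset.mem_filter]
      exact ⟨⟨this.1, hi⟩, ⟨this.2, hj⟩⟩
  · -- `k` green
    have hin : ∀ i, i ≠ k → 0 < P.1 i k → 0 < (stp P k).2 i := by
      intro i hik hi
      have e : (stp P k).2 i = _ := mc_pos_in P.1 P.2 hik hk hi
      rw [e]
      have c := cls i hik
      have c' : 2 ≤ P.1 i k := by omega
      by_cases hiM : i ∈ M
      · have := hmax i hiM
        simp only [abs_of_pos hk] at this
        have := neg_abs_le (P.2 i)
        nlinarith
      · have : 0 ≤ P.2 i := by
          by_contra hneg
          by_cases hiρ : i = ρ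
          · subst hiρ; omega
          · exact hiM (hbad i k hiρ hkρ hi (by omega) hk).1
        nlinarith
    have hout : ∀ i, i ≠ k → P.1 i k < 0 → (stp P k).2 i = P.2 i := by
      intro i hik hi
      exact mc_pos_out P.1 P.2 hik hk hi.le
    refine ⟨k, M.filter (fun i => 0 < P.1 k i), ?_, Or.inr ⟨hF'.neg, ?_, ?_, ?_⟩⟩
    · apply Finset.card_lt_card
      rw [Finset.ssubset_iff_of_subset (Finset.filter_subset _ _)]
      refine ⟨k, hkM, ?_⟩
      simp only [Finset.mem_filter, not_and]
      intro _
      omega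
    · simp only [Prod.snd_neg, Pi.neg_apply]
      omega
    · intro i hi
      rw [Finset.mem_filter] at hi
      have e : (stp P k).1 k i = _ := mutB_self_left P.1 k i
      simp only [Prod.fst_neg, Matrix.neg_apply]
      rw [e]
      omega
    · intro j i hjk hik h1 h3 h2
      simp only [Prod.fst_neg, Prod.snd_neg, Pi.neg_apply, Matrix.neg_apply] at h1 h2 h3
      have hsk := sk' j i
      have hi : 0 < P.1 k i := by
        by_contra hneg
        have := cls i hik
        have := hin i hik (by omega)
        omega
      have ci := cls i hik
      have hj : 0 < P.1 k j := by
        by_contra hneg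
        have := cls j hjk
        have := pos j i hjk hik (by omega) hi
        omega
      have cj := cls j hjk
      rw [hout i hik (by omega)] at h2
      rw [hout j hjk (by omega)] at h3
      have e : (stp P k).1 i j = _ := mutB_oo P.1 hik hjk (by omega) hj
      have hiρ : i ≠ ρ := by rintro rfl; omega
      have hjρ : j ≠ ρ := by rintro rfl; omega
      have := hbad i j hiρ hjρ (by omega) (by omega) (by omega)
      simp only [Finset.mem_filter]
      exact ⟨⟨this.2, hj⟩, ⟨this.1, hi⟩⟩

theorem stage2 : ∀ (N : ℕ) (P : Matrix V V ℤ × (V → ℤ)) (ρ : V) (M : Finset V),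
    M.card ≤ N → NV P → St P ρ M →
    ∃ (w : List V) (ρ' : V), w.length ≤ N ∧ Fk (run P w).1 ρ' ∧
      ∀ i j, i ≠ ρ' → j ≠ ρ' → 0 < (run P w).1 i j → (run P w).2 i < 0 → 0 < (run P w).2 j →
        False := by
  intro N
  have base : ∀ (P : Matrix V V ℤ × (V → ℤ)) (ρ : V), St P ρ ∅ → Fk P.1 ρ ∧
      ∀ i j, i ≠ ρ → j ≠ ρ → 0 < P.1 i j → P.2 i < 0 → 0 < P.2 j → False := by
    rintro P ρ (h | h)
    · exact ⟨h.1, fun i j h1 h2 h3 h4 h5 => by simpa using h.2.2.2 i j h1 h2 h3 h4 h5⟩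
    · have hF := h.1.neg
      simp only [Prod.fst_neg, neg_neg] at hF
      refine ⟨hF, fun i j h1 h2 h3 h4 h5 => ?_⟩
      have := h.2.2.2 j i h2 h1
      simp only [Prod.fst_neg, Prod.snd_neg, Pi.neg_apply, Matrix.neg_apply] at this
      have hs := hF.skew i j
      simpa using this (by omega) (by omega) (by omega)
  induction N with
  | zero =>
    intro P ρ M hM hnv h
    obtain rfl : M = ∅ := Finset.card_eq_zero.1 (by omega)
    exact ⟨[], ρ, le_rfl, base P ρ h⟩
  | succ N ih =>
    intro P ρ M hM hnv h
    rcases M.eq_empty_or_nonempty with rfl | hne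
    · exact ⟨[], ρ, Nat.zero_le _, base P ρ h⟩
    obtain ⟨k, M', hc, h'⟩ : ∃ k M', M'.card < M.card ∧ St (stp P k) k M' := by
      rcases h with h | h
      · exact stage2_step hnv h hne
      · obtain ⟨k, M', hc, h'⟩ := stage2_step hnv.neg h hne
        refine ⟨k, M', hc, ?_⟩
        rw [stp_neg] at h'
        simpa using h'.neg
    obtain ⟨w, ρ', hw, hres⟩ := ih (stp P k) k M' (by omega) (hnv.stp k) h'
    exact ⟨k :: w, ρ', by simpa using hw, hres⟩

/-! ### Stage 1 -/

theorem good_of_green [Fintype V] {P : Matrix V V ℤ × (V → ℤ)} {r k : V} (hF : Fk P.1 r)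
    (hkr : k ≠ r) (hk : 0 < P.2 k) (hin : ∀ i, 0 < P.1 i k → 0 < P.2 i + P.1 i k * P.2 k) :
    ∃ M, St (stp P k) k M := by
  have hF' : Fk (stp P k).1 k := hF.mutate hkr
  have hCk : (stp P k).2 k = -P.2 k := mc_self P.1 P.2 k
  have hBk : ∀ j, (stp P k).1 k j = - P.1 k j := fun j => mutB_self_left P.1 k j
  refine ⟨Finset.univ.filter (fun i => 0 < (stp P k).1 i k), Or.inr ⟨hF'.neg, ?_, ?_, ?_⟩⟩
  · simp only [Prod.snd_neg, Pi.neg_apply]; omega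
  · intro i hi
    simp only [Finset.mem_filter, Finset.mem_univ, true_and] at hi
    simp only [Prod.fst_neg, Matrix.neg_apply]
    have := hF'.skew i k
    omega
  · intro j i hjk hik h1 h3 h2
    simp only [Prod.fst_neg, Prod.snd_neg, Pi.neg_apply, Matrix.neg_apply] at h1 h2 h3
    have hsk := hF'.skew j i
    have hi : 0 < (stp P k).1 i k := by
      by_contra hneg
      have a := hF'.ab i k hik
      have b : (stp P k).1 i k = _ := mutB_self_right P.1 k i
      have c := hin i (by omega)
      have e : (stp P k).2 i = _ := mc_pos_in P.1 P.2 hik hk (by omega)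
      omega
    have hj : 0 < (stp P k).1 j k := by
      by_contra hneg
      have a := hF'.ab j k hjk
      have b := hF'.skew j k
      have := hF'.big i j hi (by omega)
      omega
    simp [hi, hj]

theorem good_of_red [Fintype V] {P : Matrix V V ℤ × (V → ℤ)} {r k : V} (hF : Fk P.1 r)
    (hkr : k ≠ r) (hk : P.2 k < 0) (hout : ∀ i, 0 < P.1 k i → P.2 i + P.1 k i * P.2 k < 0) :
    ∃ M, St (stp P k) k M := by
  obtain ⟨M, hM⟩ := good_of_green (P := -P) (k := k) hF.neg hkr (by simpa using hk) (by
    intro i hi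
    simp only [Prod.fst_neg, Prod.snd_neg, Pi.neg_apply, Matrix.neg_apply] at *
    have hs := hF.skew i k
    have := hout i (by omega)
    rw [hs] at this
    nlinarith)
  rw [stp_neg] at hM
  exact ⟨M, by simpa using hM.neg⟩

theorem exists_max_ne [Fintype V] {B : Matrix V V ℤ} {r : V} (hF : Fk B r) (c : V → ℤ) :
    ∃ k, k ≠ r ∧ ∀ i, i ≠ r → |c i| ≤ |c k| := by
  obtain ⟨j, hj⟩ := hF.ex_in
  have hjr : j ≠ r := by
    rintro rfl
    have := hF.diag j
    omega
  obtain ⟨k, hk, hm⟩ := Finset.exists_max_image (Finset.univ.filter (fun i => i ≠ r))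
    (fun i => |c i|) ⟨j, by simp [hjr]⟩
  refine ⟨k, by simpa using hk, fun i hi => hm i (by simp [hi])⟩

theorem stage1_green [Fintype V] {P : Matrix V V ℤ × (V → ℤ)} {r k : V} (hnv : NV P)
    (hF : Fk P.1 r) (hkr : k ≠ r) (hmax : ∀ i, i ≠ r → |P.2 i| ≤ |P.2 k|) (hk : 0 < P.2 k) :
    ∃ w ρ M, w.length ≤ 2 ∧ St (run P w) ρ M := by
  have hF' : Fk (stp P k).1 k := hF.mutate hkr
  have hCk : (stp P k).2 k = -P.2 k := mc_self P.1 P.2 k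
  have hBk : ∀ j, (stp P k).1 k j = - P.1 k j := fun j => mutB_self_left P.1 k j
  have hge : ∀ i, i ≠ r → 0 < P.1 i k → P.2 k ≤ P.2 i + P.1 i k * P.2 k := by
    intro i hir hi
    have h1 := hmax i hir
    rw [abs_of_pos hk] at h1
    have h2 := neg_abs_le (P.2 i)
    have hik : i ≠ k := by
      rintro rfl
      have := hF.diag i
      omega
    have h3 := hF.ab i k hik
    have h4 : 2 ≤ P.1 i k := by omega
    nlinarith
  by_cases hr : 0 < P.1 r k → 0 < P.2 r + P.1 r k * P.2 k
  · obtain ⟨M, hM⟩ := good_of_green hF hkr hk (by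
      intro i hi
      by_cases hir : i = r
      · subst hir; exact hr hi
      · have := hge i hir hi
        omega)
    exact ⟨[k], k, M, by simp, hM⟩
  push Not at hr
  obtain ⟨hrk, hrneg⟩ := hr
  have er : (stp P k).2 r = _ := mc_pos_in P.1 P.2 hkr.symm hk hrk
  obtain ⟨k2, hk2, hmax2⟩ := exists_max_ne hF' (stp P k).2
  have hnv' := hnv.stp k
  rcases lt_or_gt_of_ne (hnv'.ne k2) with h2 | h2
  · obtain ⟨M, hM⟩ := good_of_red hF' hk2 h2 (by
      intro i hi
      have hik2 : i ≠ k2 := by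
        rintro rfl
        have := hF'.diag i
        omega
      have a := hF'.ab k2 i hik2.symm
      have a' : 2 ≤ (stp P k).1 k2 i := by omega
      by_cases hik : i = k
      · subst hik
        nlinarith
      · have h1 := hmax2 i hik
        rw [abs_of_neg h2] at h1
        have := le_abs_self ((stp P k).2 i)
        nlinarith)
    exact ⟨[k, k2], k2, M, by simp, hM⟩
  · obtain ⟨M, hM⟩ := good_of_green hF' hk2 h2 (by
      intro i hi
      have hik2 : i ≠ k2 := by
        rintro rfl
        have := hF'.diag i
        omega
      have a := hF'.ab i k2 hik2
      have a' : 2 ≤ (stp P k).1 i k2 := by omega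
      by_cases hik : i = k
      · subst hik
        have hk2r : k2 ≠ r := by rintro rfl; omega
        have b := hBk k2
        have b' := hF.skew k2 i
        have e : (stp P i).2 k2 = _ := mc_pos_in P.1 P.2 hk2 hk (by omega)
        have := hge k2 hk2r (by omega)
        nlinarith
      · have h1 := hmax2 i hik
        rw [abs_of_pos h2] at h1
        have := neg_abs_le ((stp P k).2 i)
        nlinarith)
    exact ⟨[k, k2], k2, M, by simp, hM⟩

theorem stage1 [Fintype V] {P : Matrix V V ℤ × (V → ℤ)} {r : V} (hnv : NV P)
    (hF : Fk P.1 r) : ∃ w ρ M, w.length ≤ 2 ∧ St (run P w) ρ M := by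
  obtain ⟨k, hkr, hmax⟩ := exists_max_ne hF P.2
  rcases lt_or_gt_of_ne (hnv.ne k) with h | h
  · obtain ⟨w, ρ, M, hw, hM⟩ := stage1_green (P := -P) hnv.neg hF.neg hkr
      (by simpa using hmax) (by simpa using h)
    refine ⟨w, ρ, M, hw, ?_⟩
    rw [run_neg] at hM
    simpa using hM.neg
  · exact stage1_green hnv hF hkr hmax h

theorem scalar_main [Fintype V] {P : Matrix V V ℤ × (V → ℤ)} {r : V} (hnv : NV P)
    (hF : Fk P.1 r) : ∃ w : List V, w.length ≤ 2 * Fintype.card V + 3 ∧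
      (∃ ρ, Fk (run P w).1 ρ) ∧ ∃ s, ∀ i, i ≠ s → (run P w).2 i < 0 := by
  obtain ⟨w1, ρ1, M, h1, hM⟩ := stage1 hnv hF
  obtain ⟨w2, ρ2, h2, hF2, hb2⟩ := stage2 (Fintype.card V) (run P w1) ρ1 M
    (Finset.card_le_univ M) (hnv.run w1) hM
  obtain ⟨w3, h3, hF3, hr3⟩ := stage3 ρ2 (Fintype.card V) (run (run P w1) w2) ρ2
    (Finset.card_le_univ _) ((hnv.run w1).run w2) hF2 (Or.inl rfl) hF2.trans hb2
  refine ⟨w1 ++ w2 ++ w3, ?_, ?_⟩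
  · simp only [List.length_append]; omega
  · rw [run_append, run_append]
    exact ⟨hF3, ρ2, hr3⟩

/-! ### Reduction to the scalar version -/

theorem sum_neg_of_red {m : ℕ} {C : Matrix V (Fin m) ℤ} {i : V} (h : QRed C i) :
    ∑ t, C i t < 0 := by
  obtain ⟨h1, h2⟩ := h
  obtain ⟨t, ht⟩ := Function.ne_iff.1 h2
  have ht' : C i t ≠ 0 := ht
  refine Finset.sum_neg' (fun t _ => h1 t) ⟨t, Finset.mem_univ t, ?_⟩
  have := h1 t
  omega

theorem sum_pos_of_green {m : ℕ} {C : Matrix V (Fin m) ℤ} {i : V} (h : QGreen C i) :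
    0 < ∑ t, C i t := by
  obtain ⟨h1, h2⟩ := h
  obtain ⟨t, ht⟩ := Function.ne_iff.1 h2
  have ht' : C i t ≠ 0 := ht
  refine Finset.sum_pos' (fun t _ => h1 t) ⟨t, Finset.mem_univ t, ?_⟩
  have := h1 t
  omega

/-- Replace each `c`-vector by the sum of its entries. -/
def scal {m : ℕ} (P : Matrix V V ℤ × Matrix V (Fin m) ℤ) : Matrix V V ℤ × (V → ℤ) :=
  (P.1, fun i => ∑ t, P.2 i t)

theorem sum_max {m : ℕ} (f : Fin m → ℤ) (h : (∀ t, 0 ≤ f t) ∨ ∀ t, f t ≤ 0) :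
    ∑ t, max (f t) 0 = max (∑ t, f t) 0 := by
  rcases h with h | h
  · rw [max_eq_left (Finset.sum_nonneg fun t _ => h t)]
    exact Finset.sum_congr rfl fun t _ => max_eq_left (h t)
  · rw [max_eq_right (Finset.sum_nonpos fun t _ => h t)]
    exact Finset.sum_eq_zero fun t _ => max_eq_right (h t)

theorem scal_mutPair {m : ℕ} (P : Matrix V V ℤ × Matrix V (Fin m) ℤ) (k : V)
    (h : QRed P.2 k ∨ QGreen P.2 k) : scal (mutPair P k) = stp (scal P) k := by
  ext1
  · rfl
  · funext i
    simp only [scal, mutPair, stp, mutC, mc, Matrix.of_apply]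
    split_ifs with hik
    · simp
    · rw [Finset.sum_add_distrib, ← Finset.mul_sum, sum_max (fun t => P.1 i k * P.2 k t),
        ← Finset.mul_sum]
      rcases le_total 0 (P.1 i k) with a | a <;> rcases h with h | h
      · right; exact fun t => mul_nonpos_of_nonneg_of_nonpos a (h.1 t)
      · left; exact fun t => mul_nonneg a (h.1 t)
      · left; exact fun t => mul_nonneg_of_nonpos_of_nonpos a (h.1 t)
      · right; exact fun t => mul_nonpos_of_nonpos_of_nonneg a (h.1 t)

theorem scal_run {m : ℕ} (w : List V) : ∀ (P : Matrix V V ℤ × Matrix V (Fin m) ℤ), SSC P →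
    scal (mutSeqPair P w) = run (scal P) w := by
  induction w with
  | nil => intro P _; rfl
  | cons k w ih =>
    intro P h
    rw [run_cons, ← scal_mutPair P k (h [] k)]
    exact ih (mutPair P k) (fun w' i => h (k :: w') i)

end Aux

/-- Theorem `thm-tsc-fork-almost-reddening`. -/
theorem ssc_fork_almost_reddening {n m : ℕ}
    (B : Matrix (Fin n) (Fin n) ℤ) (C : Matrix (Fin n) (Fin m) ℤ)
    (hskew : ∀ i j, B j i = -B i j)
    (r : Fin n) (hfork : QFork B r)
    (hssc : SSC (B, C)) :
    ∃ w : List (Fin n), w.length ≤ 2 * n + 3 ∧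
      ∃ r' : Fin n, QFork (mutSeqPair (B, C) w).1 r' ∧
        n - 1 ≤ {i : Fin n | QRed (mutSeqPair (B, C) w).2 i}.ncard := by
  have hF : Fk B r := Fk.ofQFork hskew hfork
  have hnv : NV (scal (B, C)) := by
    intro w i
    rw [← scal_run w (B, C) hssc]
    rcases hssc w i with h | h
    · exact (sum_neg_of_red h).ne
    · exact (sum_pos_of_green h).ne'
  obtain ⟨w, hw, ⟨ρ, hρ⟩, s, hs⟩ := scalar_main (P := scal (B, C)) hnv hF
  rw [← scal_run w (B, C) hssc] at hρ hs
  refine ⟨w, by simpa using hw, ρ, hρ.toQFork, ?_⟩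
  have hsub : ((Finset.univ.erase s : Finset (Fin n)) : Set (Fin n)) ⊆
      {i : Fin n | QRed (mutSeqPair (B, C) w).2 i} := by
    intro i hi
    have his : i ≠ s := by simpa using hi
    rcases hssc w i with h | h
    · exact h
    · have h1 := sum_pos_of_green h
      have h2 : ∑ t, (mutSeqPair (B, C) w).2 i t < 0 := hs i his
      omega
  have := Set.ncard_le_ncard hsub (Set.toFinite _)
  rw [Set.ncard_coe_finset, Finset.card_erase_of_mem (Finset.mem_univ s)] at this
  simpa using this
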